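/- arXiv:1309.5847 — 2 statements merged into one kernel-verified Lean document; each statement's English description precedes it below -/
import Mathlib

section
/- Let i ≥ 1 and j ≥ 1 be integers. Then for all Laurent polynomials a, b ∈ ℂ[z,z⁻¹] there exist Laurent polynomials a′ supported in degrees [−j−i+2, j−1] and b′ supported in degrees [−j+i, j−1] such that the matrices T_{a,b} = [[z^j, u₁·a + u₂·b],[0, z^{−j−1}]] and T_{a′,b′} = [[z^j, u₁·a′ + u₂·b′],[0, z^{−j−1}]] over S are isomorphic. (Canonical form for first-order extension classes on W_i in the c₁ = 1 case.) -/
open LaurentPolynomial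

noncomputable section

/-- The ring `S = ℂ[z,z⁻¹][u₁,u₂]/(u₁,u₂)²`, with `u₁ = inr (1,0)` and `u₂ = inr (0,1)`. -/
abbrev RW : Type :=
  TrivSqZeroExt (LaurentPolynomial ℂ) (LaurentPolynomial ℂ × LaurentPolynomial ℂ)

/-- `p` is a Laurent polynomial supported in degrees `l` with `a ≤ l ≤ b`. -/
def SuppIcc (a b : ℤ) (p : LaurentPolynomial ℂ) : Prop :=
  ∃ c : ℤ → ℂ, p = ∑ l ∈ Finset.Icc a b, c l • T l

/-- `p` lies in `ℂ[z] ⊆ ℂ[z,z⁻¹]`. -/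
def InPolyZ (p : LaurentPolynomial ℂ) : Prop := ∃ N : ℤ, SuppIcc 0 N p

/-- `p` lies in `z^m·ℂ[z⁻¹]`, i.e. is supported in degrees `≤ m`. -/
def SuppLe (m : ℤ) (p : LaurentPolynomial ℂ) : Prop := ∃ N : ℤ, SuppIcc N m p

/-- The subring `O_U = { f(z) + g₁(z)·u₁ + g₂(z)·u₂ }` of `S`. -/
def OUW : Set RW := { x | InPolyZ x.fst ∧ InPolyZ x.snd.1 ∧ InPolyZ x.snd.2 }

/-- The subring `O_V = { f(z⁻¹) + g₁(z⁻¹)·z^{2-i}·u₁ + g₂(z⁻¹)·zⁱ·u₂ }` of `S`. -/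
def OVW (i : ℤ) : Set RW :=
  { x | SuppLe 0 x.fst ∧ SuppLe (2 - i) x.snd.1 ∧ SuppLe i x.snd.2 }

/-- Two 2×2 matrices `T`, `T'` over a ring `A` are isomorphic with respect to
subrings (given as subsets) `SU`, `SV` if `T'·M = N·T` for some matrices `M` (entries
in `SU`) and `N` (entries in `SV`), each invertible with inverse entries in the
same subring. -/
def MatIso {A : Type*} [Ring A] (SU SV : Set A)
    (T T' : Matrix (Fin 2) (Fin 2) A) : Prop :=
  ∃ M M' N N' : Matrix (Fin 2) (Fin 2) A,
    (∀ a b, M a b ∈ SU) ∧ (∀ a b, M' a b ∈ SU) ∧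
    (∀ a b, N a b ∈ SV) ∧ (∀ a b, N' a b ∈ SV) ∧
    M * M' = 1 ∧ M' * M = 1 ∧ N * N' = 1 ∧ N' * N = 1 ∧
    T' * M = N * T

/-- The transition matrix `[[z^{d₁}, u₁·a + u₂·b],[0, z^{d₂}]]` over `S`. -/
def TmatW (d₁ d₂ : ℤ) (a b : LaurentPolynomial ℂ) : Matrix (Fin 2) (Fin 2) RW :=
  !![TrivSqZeroExt.inl (T d₁), TrivSqZeroExt.inr (a, b);
     0, TrivSqZeroExt.inl (T d₂)]

theorem SuppIcc.mono {a b a' b' : ℤ} {p : LaurentPolynomial ℂ} (h : SuppIcc a b p)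
    (ha : a' ≤ a) (hb : b ≤ b') : SuppIcc a' b' p := by
  obtain ⟨c, rfl⟩ := h
  refine ⟨fun l => if l ∈ Finset.Icc a b then c l else 0, ?_⟩
  simp only [ite_smul, zero_smul]
  rw [Finset.sum_ite_mem, Finset.inter_eq_right.2 (Finset.Icc_subset_Icc ha hb)]

theorem SuppIcc.add {a b : ℤ} {p q : LaurentPolynomial ℂ} (hp : SuppIcc a b p)
    (hq : SuppIcc a b q) : SuppIcc a b (p + q) := by
  obtain ⟨c, rfl⟩ := hp
  obtain ⟨d, rfl⟩ := hq
  exact ⟨c + d, by simp [add_smul, Finset.sum_add_distrib]⟩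

theorem SuppIcc.neg {a b : ℤ} {p : LaurentPolynomial ℂ} (hp : SuppIcc a b p) :
    SuppIcc a b (-p) := by
  obtain ⟨c, rfl⟩ := hp
  exact ⟨-c, by simp⟩

theorem suppIcc_zero (a b : ℤ) : SuppIcc a b 0 := ⟨0, by simp⟩

theorem suppIcc_C_mul_T (x : ℂ) (n : ℤ) : SuppIcc n n (C x * T n) :=
  ⟨fun _ => x, by simp [LaurentPolynomial.smul_eq_C_mul]⟩

theorem suppIcc_one : SuppIcc 0 0 1 := by
  simpa using suppIcc_C_mul_T 1 0

theorem InPolyZ.add {p q : LaurentPolynomial ℂ} (hp : InPolyZ p) (hq : InPolyZ q) :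
    InPolyZ (p + q) := by
  obtain ⟨m, hp⟩ := hp
  obtain ⟨n, hq⟩ := hq
  exact ⟨max m n, (hp.mono le_rfl (le_max_left _ _)).add (hq.mono le_rfl (le_max_right _ _))⟩

theorem InPolyZ.neg {p : LaurentPolynomial ℂ} (hp : InPolyZ p) : InPolyZ (-p) :=
  hp.imp fun _ h => h.neg

theorem inPolyZ_zero : InPolyZ 0 := ⟨0, suppIcc_zero _ _⟩

theorem SuppLe.add {k : ℤ} {p q : LaurentPolynomial ℂ} (hp : SuppLe k p) (hq : SuppLe k q) :
    SuppLe k (p + q) := by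
  obtain ⟨m, hp⟩ := hp
  obtain ⟨n, hq⟩ := hq
  exact ⟨min m n, (hp.mono (min_le_left _ _) le_rfl).add (hq.mono (min_le_right _ _) le_rfl)⟩

theorem SuppLe.neg {k : ℤ} {p : LaurentPolynomial ℂ} (hp : SuppLe k p) : SuppLe k (-p) :=
  hp.imp fun _ h => h.neg

theorem suppLe_zero (k : ℤ) : SuppLe k 0 := ⟨0, suppIcc_zero _ _⟩

/-- Every Laurent polynomial splits into a part in `z^h·ℂ[z]`, a part in `z^(d+m)·ℂ[z⁻¹]`
and a remainder supported strictly between these ranges. -/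
theorem exists_suppIcc_add_T_mul (h d m : ℤ) (p : LaurentPolynomial ℂ) :
    ∃ q f g : LaurentPolynomial ℂ, SuppIcc (d + m + 1) (h - 1) q ∧ InPolyZ f ∧ SuppLe m g ∧
      p = q + T h * f + T d * g := by
  induction p using LaurentPolynomial.induction_on' with
  | add p₁ p₂ h₁ h₂ =>
    obtain ⟨q₁, f₁, g₁, hq₁, hf₁, hg₁, rfl⟩ := h₁
    obtain ⟨q₂, f₂, g₂, hq₂, hf₂, hg₂, rfl⟩ := h₂
    exact ⟨q₁ + q₂, f₁ + f₂, g₁ + g₂, hq₁.add hq₂, hf₁.add hf₂, hg₁.add hg₂, by ring⟩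
  | C_mul_T n x =>
    rcases le_or_gt h n with hn | hn
    · exact ⟨0, C x * T (n - h), 0, suppIcc_zero _ _,
        ⟨_, (suppIcc_C_mul_T x (n - h)).mono (by omega) le_rfl⟩, suppLe_zero _,
        by simp⟩
    rcases le_or_gt n (d + m) with hn' | hn'
    · exact ⟨0, 0, C x * T (n - d), suppIcc_zero _ _, inPolyZ_zero,
        ⟨_, (suppIcc_C_mul_T x (n - d)).mono le_rfl (by omega)⟩,
        by simp⟩
    · exact ⟨C x * T n, 0, 0, (suppIcc_C_mul_T x n).mono (by omega) (by omega),
        inPolyZ_zero, suppLe_zero _, by simp⟩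

theorem unipotent_mul_unipotent_neg {R : Type*} [Ring R] (x : R) :
    !![1, x; 0, 1] * !![1, -x; 0, 1] = (1 : Matrix (Fin 2) (Fin 2) R) := by
  simp [Matrix.one_fin_two]

theorem unipotent_neg_mul_unipotent {R : Type*} [Ring R] (x : R) :
    !![1, -x; 0, 1] * !![1, x; 0, 1] = (1 : Matrix (Fin 2) (Fin 2) R) := by
  simpa using unipotent_mul_unipotent_neg (-x)

theorem unipotent_mem_OUW {f₁ f₂ : LaurentPolynomial ℂ} (h₁ : InPolyZ f₁) (h₂ : InPolyZ f₂)
    (r s : Fin 2) :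
    (!![1, TrivSqZeroExt.inr (f₁, f₂); 0, 1] : Matrix (Fin 2) (Fin 2) RW) r s ∈ OUW := by
  have one : InPolyZ 1 := ⟨0, suppIcc_one⟩
  fin_cases r <;> fin_cases s <;> simp [OUW, inPolyZ_zero, one, h₁, h₂]

theorem unipotent_mem_OVW {i : ℤ} {g₁ g₂ : LaurentPolynomial ℂ} (h₁ : SuppLe (2 - i) g₁)
    (h₂ : SuppLe i g₂) (r s : Fin 2) :
    (!![1, TrivSqZeroExt.inr (g₁, g₂); 0, 1] : Matrix (Fin 2) (Fin 2) RW) r s ∈ OVW i := by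
  have one : SuppLe 0 1 := ⟨0, suppIcc_one⟩
  fin_cases r <;> fin_cases s <;> simp [OVW, suppLe_zero, one, h₁, h₂]

/-- Changing the off-diagonal entry by `z^{d₁}·O_U` and `z^{d₂}·O_V` gives an isomorphic matrix. -/
theorem matIso_TmatW {i : ℤ} (d₁ d₂ : ℤ) (a b : LaurentPolynomial ℂ)
    {f₁ f₂ g₁ g₂ : LaurentPolynomial ℂ} (hf₁ : InPolyZ f₁) (hf₂ : InPolyZ f₂)
    (hg₁ : SuppLe (2 - i) g₁) (hg₂ : SuppLe i g₂) :
    MatIso OUW (OVW i) (TmatW d₁ d₂ (a + T d₁ * f₁ + T d₂ * g₁) (b + T d₁ * f₂ + T d₂ * g₂))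
      (TmatW d₁ d₂ a b) := by
  have hneg (p q : LaurentPolynomial ℂ) :
      -(TrivSqZeroExt.inr (p, q) : RW) = TrivSqZeroExt.inr (-p, -q) := by
    rw [← TrivSqZeroExt.inr_neg, Prod.neg_mk]
  refine ⟨!![1, TrivSqZeroExt.inr (f₁, f₂); 0, 1], !![1, -TrivSqZeroExt.inr (f₁, f₂); 0, 1],
    !![1, -TrivSqZeroExt.inr (g₁, g₂); 0, 1], !![1, TrivSqZeroExt.inr (g₁, g₂); 0, 1],
    unipotent_mem_OUW hf₁ hf₂, ?_, ?_, unipotent_mem_OVW hg₁ hg₂,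
    unipotent_mul_unipotent_neg _, unipotent_neg_mul_unipotent _,
    unipotent_neg_mul_unipotent _, unipotent_mul_unipotent_neg _, ?_⟩
  · rw [hneg]
    exact unipotent_mem_OUW hf₁.neg hf₂.neg
  · rw [hneg]
    exact unipotent_mem_OVW hg₁.neg hg₂.neg
  · have key : (TrivSqZeroExt.inl (T d₁) * TrivSqZeroExt.inr (f₁, f₂) +
        TrivSqZeroExt.inr (a, b) : RW) =
        TrivSqZeroExt.inr (a + T d₁ * f₁ + T d₂ * g₁, b + T d₁ * f₂ + T d₂ * g₂) -
          TrivSqZeroExt.inr (g₁, g₂) * TrivSqZeroExt.inl (T d₂) := by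
      rw [TrivSqZeroExt.inl_mul_inr, TrivSqZeroExt.inr_mul_inl, op_smul_eq_smul,
        ← TrivSqZeroExt.inr_add, ← TrivSqZeroExt.inr_sub]
      congr 1
      ext1 <;> simp <;> ring
    simp [TmatW, key, sub_eq_add_neg]

theorem stmt7 (i j : ℤ) (hi : 1 ≤ i) (hj : 1 ≤ j) (a b : LaurentPolynomial ℂ) :
    ∃ a' b' : LaurentPolynomial ℂ,
      SuppIcc (-j - i + 2) (j - 1) a' ∧ SuppIcc (-j + i) (j - 1) b' ∧
      MatIso OUW (OVW i) (TmatW j (-j - 1) a b) (TmatW j (-j - 1) a' b') := by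
  obtain ⟨a', f₁, g₁, ha', hf₁, hg₁, rfl⟩ := exists_suppIcc_add_T_mul j (-j - 1) (2 - i) a
  obtain ⟨b', f₂, g₂, hb', hf₂, hg₂, rfl⟩ := exists_suppIcc_add_T_mul j (-j - 1) i b
  exact ⟨a', b', ha'.mono (by omega) le_rfl, hb'.mono (by omega) le_rfl,
    matIso_TmatW j (-j - 1) a' b' hf₁ hf₂ hg₁ hg₂⟩
end
end

section
/- Let i, j be integers with 1 ≤ i ≤ 2j. Consider pairs (a,b) of Laurent polynomials with a supported in degrees [−j−i+2, j−1] and b supported in degrees [−j+i, j−1]; identify such a pair with its coefficient vector in ℂ^{4j−2} (there are 2j+i−2 coefficients for a and 2j−i for b). Then the map sending a nonzero such pair to the isomorphism class of T_{a,b} = [[z^j, u₁·a + u₂·b],[0, z^{−j−1}]] descends to a well-defined bijection from ℙ^{4j−3} = ℙ(ℂ^{4j−2}) onto the set of isomorphism classes of matrices T_{a,b} with (a,b) ≠ 0 supported as above. (This identifies the moduli space 𝔐¹_j(W_i, 1) of nontrivial first-order deformations with c₁ = 1 on W_i with ℙ^{4j−3}.) -/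
open LaurentPolynomial

noncomputable section

/-- The pair of Laurent polynomials `(a,b)` with `a` supported in degrees
`[-j-i+2, j-1]` and `b` supported in degrees `[-j+i, j-1]`, with coefficient
vector `v ∈ ℂ^{2j+i-2} × ℂ^{2j-i} = ℂ^{4j-2}`. -/
def pairOf (i j : ℤ)
    (v : (Fin (2 * j + i - 2).toNat → ℂ) × (Fin (2 * j - i).toNat → ℂ)) :
    LaurentPolynomial ℂ × LaurentPolynomial ℂ :=
  (∑ t : Fin (2 * j + i - 2).toNat, v.1 t • T (-j - i + 2 + (t : ℤ)),
   ∑ t : Fin (2 * j - i).toNat, v.2 t • T (-j + i + (t : ℤ)))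

/-- Isomorphism of the transition matrices `T_{a,b} = [[z^j, u₁·a + u₂·b],[0, z^{-j-1}]]`,
as a relation on nonzero coefficient vectors. -/
def relW1 (i j : ℤ)
    (v w : {v : (Fin (2 * j + i - 2).toNat → ℂ) × (Fin (2 * j - i).toNat → ℂ) // v ≠ 0}) :
    Prop :=
  MatIso OUW (OVW i)
    (TmatW j (-j - 1) (pairOf i j v).1 (pairOf i j v).2)
    (TmatW j (-j - 1) (pairOf i j w).1 (pairOf i j w).2)

theorem coeff_T_mul (m n : ℤ) (p : LaurentPolynomial ℂ) :
    (T m * p).coeff n = p.coeff (n - m) := by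
  simpa using AddMonoidAlgebra.coeff_single_mul_add p (1 : ℂ) m (n - m)

theorem coeff_mul_T (m n : ℤ) (p : LaurentPolynomial ℂ) :
    (p * T m).coeff n = p.coeff (n - m) := by
  rw [← T_mul, coeff_T_mul]

theorem SuppIcc.coeff_eq_zero {a b n : ℤ} {p : LaurentPolynomial ℂ} (h : SuppIcc a b p)
    (hn : n < a ∨ b < n) : p.coeff n = 0 := by
  obtain ⟨c, rfl⟩ := h
  rw [AddMonoidAlgebra.coeff_sum, Finset.sum_apply']
  refine Finset.sum_eq_zero fun l hl ↦ ?_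
  rw [Finset.mem_Icc] at hl
  have : l ≠ n := by omega
  simp [this]

theorem InPolyZ.coeff_eq_zero {n : ℤ} {p : LaurentPolynomial ℂ} (h : InPolyZ p) (hn : n < 0) :
    p.coeff n = 0 :=
  let ⟨_, h⟩ := h
  h.coeff_eq_zero (.inl hn)

theorem SuppLe.coeff_eq_zero {m n : ℤ} {p : LaurentPolynomial ℂ} (h : SuppLe m p) (hn : m < n) :
    p.coeff n = 0 :=
  let ⟨_, h⟩ := h
  h.coeff_eq_zero (.inr hn)

theorem suppIcc_C (c : ℂ) : SuppIcc 0 0 (C c) := ⟨fun _ ↦ c, by simp [smul_eq_C_mul]⟩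

theorem coeff_sum_smul_T (s : ℤ) {n : ℕ} (c : Fin n → ℂ) (t : Fin n) :
    (∑ u : Fin n, c u • (T (s + (u : ℤ)) : LaurentPolynomial ℂ)).coeff (s + (t : ℤ)) = c t := by
  rw [AddMonoidAlgebra.coeff_sum, Finset.sum_apply', Finset.sum_eq_single t]
  · simp
  · intro u _ hu
    have : (u : ℤ) ≠ t := by
      intro h
      exact hu (Fin.ext (by exact_mod_cast h))
    simp [this]
  · simp

theorem pairOf_smul (i j : ℤ) (c : ℂ)
    (v : (Fin (2 * j + i - 2).toNat → ℂ) × (Fin (2 * j - i).toNat → ℂ)) :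
    pairOf i j (c • v) = c • pairOf i j v := by
  simp [pairOf, Finset.smul_sum, mul_smul]

/-- An isomorphism between two transition matrices forces their off-diagonal entries to have
proportional coefficients in all degrees not absorbed by the two charts. -/
theorem MatIso.exists_coeff_eq {i d₁ d₂ : ℤ} (hd : d₂ < d₁) {a b a' b' : LaurentPolynomial ℂ}
    (h : MatIso OUW (OVW i) (TmatW d₁ d₂ a b) (TmatW d₁ d₂ a' b')) :
    ∃ x y : ℂ, x ≠ 0 ∧ y ≠ 0 ∧
      (∀ n, d₂ + 2 - i < n → n < d₁ → y * a'.coeff n = x * a.coeff n) ∧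
      (∀ n, d₂ + i < n → n < d₁ → y * b'.coeff n = x * b.coeff n) := by
  obtain ⟨M, M', N, N', hM, -, hN, -, hMM', hM'M, -, -, h⟩ := h
  have h00 := congr($h 0 0)
  have h01 := congr($h 0 1)
  have h11 := congr($h 1 1)
  have hMM := congr(($hMM' 0 0).fst)
  have hMM₂ := congr(($hM'M 1 1).fst)
  simp only [TmatW, Matrix.mul_apply, Fin.sum_univ_two, Matrix.of_apply, Matrix.cons_val',
    Matrix.cons_val_zero, Matrix.cons_val_one, Matrix.cons_val_fin_one] at h00 h01 h11
  replace h00 := congr(($h00).fst)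
  replace h11 := congr(($h11).fst)
  have f01 := congr(($h01).fst)
  have s01 := congr(($h01).snd.1)
  have s01' := congr(($h01).snd.2)
  simp [Matrix.mul_apply, Fin.sum_univ_two] at h00 h11 f01 s01 s01' hMM hMM₂
  have hT (n : ℤ) : (T n : LaurentPolynomial ℂ) ≠ 0 := (isUnit_T n).ne_zero
  replace h00 := h00.resolve_right (hT _)
  replace h11 := h11.resolve_right (hT _)
  have m01 : (M 0 1).fst = 0 := by
    ext n
    rcases lt_or_ge n 0 with hn | hn
    · exact (hM 0 1).1.coeff_eq_zero hn
    · have := congr(($f01).coeff (n + d₁))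
      rw [coeff_mul_T, coeff_mul_T, (hN 0 1).1.coeff_eq_zero (by omega)] at this
      simpa using this
  have hconst (k : Fin 2) (hk : (M k k).fst = (N k k).fst) :
      (M k k).fst = C ((M k k).fst.coeff 0) := by
    ext n
    rw [C_apply]
    split_ifs with hn
    · rw [hn]
    · rcases lt_or_gt_of_ne hn with hn | hn
      · exact (hM k k).1.coeff_eq_zero hn
      · rw [hk]
        exact (hN k k).1.coeff_eq_zero hn
  have hx := hconst 0 h00
  have hy := hconst 1 h11
  set x := (M 0 0).fst.coeff 0
  set y := (M 1 1).fst.coeff 0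
  rw [← h00, hx, hy] at s01 s01'
  rw [m01, hx] at hMM
  rw [m01, hy] at hMM₂
  refine ⟨x, y, ?_, ?_, fun n hn hn' ↦ ?_, fun n hn hn' ↦ ?_⟩
  · rintro h
    simp [h] at hMM
  · rintro h
    simp [h] at hMM₂
  · have := congr(($s01).coeff n)
    rw [mul_comm a'] at this
    simpa [← smul_eq_C_mul, coeff_mul_T, (hM 0 1).2.1.coeff_eq_zero (sub_neg.2 hn'),
      (hN 0 1).2.1.coeff_eq_zero (show 2 - i < n - d₂ by omega)] using this
  · have := congr(($s01').coeff n)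
    rw [mul_comm b'] at this
    simpa [← smul_eq_C_mul, coeff_mul_T, (hM 0 1).2.2.coeff_eq_zero (sub_neg.2 hn'),
      (hN 0 1).2.2.coeff_eq_zero (show i < n - d₂ by omega)] using this

theorem matIso_smul (i d₁ d₂ : ℤ) {c : ℂ} (hc : c ≠ 0) (a b : LaurentPolynomial ℂ) :
    MatIso OUW (OVW i) (TmatW d₁ d₂ a b) (TmatW d₁ d₂ (c • a) (c • b)) := by
  let D (x : ℂ) : Matrix (Fin 2) (Fin 2) RW := Matrix.diagonal ![.inl (C x), .inl (C 1)]
  have hD {x y : ℂ} (h : x * y = 1) : D x * D y = 1 := by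
    rw [Matrix.diagonal_mul_diagonal, ← Matrix.diagonal_one]
    congr 1
    ext k : 1
    fin_cases k <;> simp [← TrivSqZeroExt.inl_mul, ← map_mul, h]
  have hentry (x : ℂ) (k l) : ∃ c : ℂ, D x k l = .inl (C c) := by
    fin_cases k <;> fin_cases l
    exacts [⟨x, rfl⟩, ⟨0, by simp [D]⟩, ⟨0, by simp [D]⟩, ⟨1, rfl⟩]
  have hU (x : ℂ) (k l) : D x k l ∈ OUW := by
    obtain ⟨c, h⟩ := hentry x k l
    rw [h]
    exact ⟨⟨0, suppIcc_C c⟩, ⟨0, suppIcc_zero _ _⟩, ⟨0, suppIcc_zero _ _⟩⟩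
  have hV (x : ℂ) (k l) : D x k l ∈ OVW i := by
    obtain ⟨c, h⟩ := hentry x k l
    rw [h]
    exact ⟨⟨0, suppIcc_C c⟩, ⟨0, suppIcc_zero _ _⟩, ⟨0, suppIcc_zero _ _⟩⟩
  refine ⟨D c, D c⁻¹, D c, D c⁻¹, hU _, hU _, hV _, hV _, hD (mul_inv_cancel₀ hc),
    hD (inv_mul_cancel₀ hc), hD (mul_inv_cancel₀ hc), hD (inv_mul_cancel₀ hc), ?_⟩
  refine Matrix.ext fun k l ↦ ?_
  rw [Matrix.mul_diagonal, Matrix.diagonal_mul]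
  fin_cases k <;> fin_cases l
  · exact mul_comm _ _
  · simp [TmatW, smul_eq_C_mul, TrivSqZeroExt.inl_mul_inr]
  · simp [TmatW]
  · exact mul_comm _ _

theorem relW1_iff {i j : ℤ} (hj : 1 ≤ j)
    (v w : {v : (Fin (2 * j + i - 2).toNat → ℂ) × (Fin (2 * j - i).toNat → ℂ) // v ≠ 0}) :
    relW1 i j v w ↔ ∃ c : ℂˣ, c • w.1 = v.1 := by
  constructor
  · intro h
    obtain ⟨x, y, hx, hy, ha, hb⟩ := h.exists_coeff_eq (by omega)
    refine ⟨Units.mk0 (y / x) (div_ne_zero hy hx), Prod.ext ?_ ?_⟩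
    · funext t
      have := ha (-j - i + 2 + (t : ℤ)) (by omega) (by omega)
      simp only [pairOf, coeff_sum_smul_T] at this
      simp [Units.smul_def]
      field_simp
      exact this
    · funext t
      have := hb (-j + i + (t : ℤ)) (by omega) (by omega)
      simp only [pairOf, coeff_sum_smul_T] at this
      simp [Units.smul_def]
      field_simp
      exact this
  · rintro ⟨c, hc⟩
    have hw : w.1 = (c⁻¹ : ℂ) • v.1 := by
      rw [← hc, Units.smul_def, smul_smul, inv_mul_cancel₀ c.ne_zero, one_smul]
    unfold relW1
    rw [hw, pairOf_smul]
    exact matIso_smul i _ _ (inv_ne_zero c.ne_zero) _ _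

theorem stmt8 (i j : ℤ) (hi : 1 ≤ i) (hij : i ≤ 2 * j) :
    ∃ e : Projectivization ℂ ((Fin (2 * j + i - 2).toNat → ℂ) × (Fin (2 * j - i).toNat → ℂ)) ≃
        Quot (relW1 i j),
      ∀ (v : (Fin (2 * j + i - 2).toNat → ℂ) × (Fin (2 * j - i).toNat → ℂ)) (hv : v ≠ 0),
        e (Projectivization.mk ℂ v hv) = Quot.mk (relW1 i j) ⟨v, hv⟩ := by
  exact ⟨Quot.congrRight (r := (projectivizationSetoid ℂ _).r) fun v w ↦
    (relW1_iff (by omega) v w).symm, fun _ _ ↦ rfl⟩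
end
end
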